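/- Let q be an algebraic Lie algebra such that k[q*]^q = k[f₁,…,f_l] is a graded polynomial ring with l = ind q, and assume Ω_{q*} = {ξ : (df₁)_ξ ∧ ⋯ ∧ (df_l)_ξ ≠ 0} is big in q*. Then for every m ≥ 1, k[q⟨m⟩*]^{q⟨m⟩} is a graded polynomial ring of Krull dimension (m+1)l, freely generated by the polarizations F_i^j (1 ≤ i ≤ l, 0 ≤ j ≤ m) of the f_i. -/

import Mathlib

open Module MvPolynomial

variable (k : Type*) [Field k]

section Defs

variable {L ι : Type*} [LieRing L] [LieAlgebra k L] [Fintype ι]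

/-- The coadjoint stabiliser `q_ξ`. -/
noncomputable def coadStab (ξ : Module.Dual k L) : Submodule k L where
  carrier := {x : L | ∀ y : L, ξ ⁅x, y⁆ = 0}
  add_mem' := by intro a b ha hb y; simp [add_lie, ha y, hb y]
  zero_mem' := by intro y; simp
  smul_mem' := by intro c a ha y; simp [smul_lie, ha y]

/-- The index of `q`: minimal dimension of a coadjoint stabiliser. -/
noncomputable def lieIndex (k L : Type*) [Field k] [LieRing L] [LieAlgebra k L] : ℕ :=
  sInf {d : ℕ | ∃ ξ : Module.Dual k L, d = Module.finrank k (coadStab k ξ)}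

/-- `g ∈ k[q*]` is a symmetric invariant of `q`: in the coordinates given by the
basis `b`, `{g, x} = 0` for every `x ∈ q` (for connected `Q` this is
`Q`-invariance). -/
def IsLieInvariant (b : Basis ι k L) (g : MvPolynomial ι k) : Prop :=
  ∀ (j : ι) (c : ι → k),
    ∑ i, MvPolynomial.eval c (MvPolynomial.pderiv i g) *
      (∑ r, c r * b.repr ⁅b i, b j⁆ r) = 0

/-- The set `Ω_{q*}` of points where the differentials of `f 0, …, f (l-1)` are
linearly independent. -/
def omegaSet {l : ℕ} (f : Fin l → MvPolynomial ι k) : Set (ι → k) :=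
  {c | LinearIndependent k
    (fun t : Fin l => fun i : ι => MvPolynomial.eval c (MvPolynomial.pderiv i (f t)))}

/-- The Takiff bracket on `q⟨m⟩`. -/
def takiffBracket (m : ℕ) (x y : Fin (m + 1) → L) : Fin (m + 1) → L :=
  fun l => ∑ i : Fin (m + 1), ∑ j : Fin (m + 1),
    if (i : ℕ) + (j : ℕ) = (l : ℕ) then ⁅x i, y j⁆ else 0

/-- Pairing of a point of `q⟨m⟩*` (in coordinates) with an element of `q⟨m⟩`. -/
noncomputable def takiffPairing (b : Basis ι k L) (m : ℕ)
    (c : Fin (m + 1) × ι → k) (x : Fin (m + 1) → L) : k :=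
  ∑ p : Fin (m + 1) × ι, c p * b.repr (x p.1) p.2

/-- `F ∈ k[q⟨m⟩*]` is a symmetric invariant of the Takiff algebra `q⟨m⟩`. -/
noncomputable def IsTakiffInvariant (b : Basis ι k L) (m : ℕ)
    (F : MvPolynomial (Fin (m + 1) × ι) k) : Prop :=
  ∀ (p : Fin (m + 1) × ι) (c : Fin (m + 1) × ι → k),
    ∑ q : Fin (m + 1) × ι,
      MvPolynomial.eval c (MvPolynomial.pderiv q F) *
        takiffPairing k b m c
          (takiffBracket m (Pi.single q.1 (b q.2)) (Pi.single p.1 (b p.2))) = 0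

/-- The Raïs–Tauvel polarization `F^j` of `f`, as a polynomial on `q⟨m⟩*`. -/
noncomputable def polarizationPoly (m : ℕ) (f : MvPolynomial ι k) (j : ℕ) :
    MvPolynomial (Fin (m + 1) × ι) k :=
  Polynomial.coeff
    (MvPolynomial.aeval
      (fun i : ι => ∑ r : Fin (m + 1),
        Polynomial.C (MvPolynomial.X (r, i) : MvPolynomial (Fin (m + 1) × ι) k) *
          Polynomial.X ^ (m - (r : ℕ))) f) j

end Defs

theorem Matrix.exists_mul_eq_one_of_linearIndependent_row {K κ ι : Type*} [Field K] [Fintype κ]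
    [DecidableEq κ] [Fintype ι] (N : Matrix κ ι K) (hN : LinearIndependent K N.row) :
    ∃ B : Matrix ι κ K, N * B = 1 := by
  classical
  obtain ⟨g, hg⟩ := N.vecMulLinear.exists_leftInverse_of_injective
    (LinearMap.ker_eq_bot.2 (Matrix.vecMul_injective_iff.2 hN))
  refine ⟨LinearMap.toMatrixRight' g, ?_⟩
  apply Matrix.toLinearMapRight'.injective
  rw [Matrix.toLinearMapRight'_mul, Matrix.toLinearMapRight'_one,
    show Matrix.toLinearMapRight' (LinearMap.toMatrixRight' g) = g by simp]
  exact hg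

/-- If the rows of a matrix over `R` are independent after specialisation, the matrix has a right
inverse up to a scalar that does not vanish under the specialisation. -/
theorem Matrix.exists_mul_eq_smul_one_of_specialization {k R κ ι : Type*} [Field k] [CommRing R]
    [Algebra k R] [Fintype κ] [DecidableEq κ] [Fintype ι] (e : R →ₐ[k] k) (p : Matrix κ ι R)
    (hp : LinearIndependent k (p.map e).row) :
    ∃ (s : Matrix ι κ R) (Δ : R), p * s = Δ • (1 : Matrix κ κ R) ∧ e Δ = 1 := by
  obtain ⟨B, hB⟩ := Matrix.exists_mul_eq_one_of_linearIndependent_row _ hp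
  refine ⟨B.map (algebraMap k R) * (p * B.map (algebraMap k R)).adjugate,
    (p * B.map (algebraMap k R)).det, ?_, ?_⟩
  · rw [← Matrix.mul_assoc, Matrix.mul_adjugate]
  · have h : (e : R →+* k).mapMatrix (p * B.map (algebraMap k R)) = 1 := by
      rw [← hB, RingHom.mapMatrix_apply, Matrix.map_mul, Matrix.map_map]
      congr 1
      ext i j
      simp
    have := RingHom.map_det (e : R →+* k) (p * B.map (algebraMap k R))
    rw [h, Matrix.det_one] at this
    exact this

theorem Matrix.card_le_rank_of_mul_eq_smul_one {R K κ ι : Type*} [CommRing R] [IsDomain R]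
    [Field K] [Algebra R K] [IsFractionRing R K] [Fintype κ] [DecidableEq κ] [Fintype ι]
    {p : Matrix κ ι R} {s : Matrix ι κ R} {Δ : R} (hΔ : Δ ≠ 0)
    (h : p * s = Δ • (1 : Matrix κ κ R)) :
    Fintype.card κ ≤ (p.map (algebraMap R K)).rank := by
  have h' : p.map (algebraMap R K) * s.map (algebraMap R K) =
      algebraMap R K Δ • (1 : Matrix κ κ K) := by
    rw [← Matrix.map_mul, h]
    ext i j
    simp [Matrix.one_apply, apply_ite (algebraMap R K)]
  have hd : (algebraMap R K Δ • (1 : Matrix κ κ K)).det ≠ 0 := by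
    rw [Matrix.det_smul, Matrix.det_one, mul_one]
    exact pow_ne_zero _ ((map_ne_zero_iff _ (IsFractionRing.injective R K)).2 hΔ)
  rw [← Matrix.rank_of_det_ne_zero hd, ← h']
  exact Matrix.rank_mul_le_left _ _

theorem Matrix.rank_map_algHom_le {k R ι κ : Type*} (K : Type*) [Field k] [CommRing R] [IsDomain R]
    [Algebra k R] [Field K] [Algebra R K] [IsFractionRing R K] [Fintype ι] [Fintype κ]
    (e : R →ₐ[k] k) (M : Matrix κ ι R) :
    (M.map e).rank ≤ (M.map (algebraMap R K)).rank := by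
  classical
  obtain ⟨τ, a, ha, hspan, hli⟩ := exists_linearIndependent' k (M.map e).row
  have := Fintype.ofInjective a ha
  obtain ⟨s, Δ, hs, hΔ⟩ := Matrix.exists_mul_eq_smul_one_of_specialization e (M.submatrix a id) hli
  have hΔ0 : Δ ≠ 0 := by rintro rfl; simp at hΔ
  calc (M.map e).rank = Fintype.card τ := by
        rw [Matrix.rank_eq_finrank_span_row, ← hspan, finrank_span_eq_card hli]
    _ ≤ ((M.submatrix a id).map (algebraMap R K)).rank :=
        Matrix.card_le_rank_of_mul_eq_smul_one hΔ0 hs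
    _ ≤ (M.map (algebraMap R K)).rank := Matrix.rank_submatrix_le (M.map (algebraMap R K)) a id

/-- Chain rule. -/
theorem Derivation.map_aeval_mvPolynomial {k ι B : Type*} [CommRing k] [CommRing B] [Algebra k B]
    [Fintype ι] (D : Derivation k B B) (x : ι → B) (f : MvPolynomial ι k) :
    D (aeval x f) = ∑ i, aeval x (pderiv i f) * D (x i) := by
  classical
  induction f using MvPolynomial.induction_on with
  | C a => simp
  | add p q hp hq => simp [hp, hq, add_mul, Finset.sum_add_distrib]
  | mul_X p j hp =>
    simp only [map_mul, aeval_X, Derivation.leibniz, hp, smul_eq_mul, pderiv_X, map_add, add_mul,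
      Finset.sum_add_distrib, Finset.mul_sum]
    congr 1
    · rw [Finset.sum_eq_single j] <;> simp +contextual [eq_comm]
    · exact Finset.sum_congr rfl fun i _ => by ring

/-- A polynomial killed by the constant vector fields given by the columns of `w` is invariant
under translation along them. -/
theorem MvPolynomial.aeval_X_sub_eq_self {K ι : Type*} [Field K] [CharZero K] [Fintype ι]
    (G : MvPolynomial ι K) (w : Matrix ι ι K)
    (hw : ∀ j, ∑ i, C (w i j) * pderiv i G = 0) :
    aeval (fun i => X i - ∑ j, C (w i j) * X j) G = G := by
  let v : ι → MvPolynomial ι K := fun i => ∑ j, C (w i j) * X j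
  let φ : MvPolynomial ι K →ₐ[K] Polynomial (MvPolynomial ι K) :=
    aeval fun i => Polynomial.C (X i) - Polynomial.X * Polynomial.C (v i)
  have hφC (a : K) : φ (C a) = Polynomial.C (C a) := by
    simp [φ, algHom_C]
  have hder : Polynomial.derivative (φ G) = 0 := by
    have := ((Polynomial.derivative' (R := MvPolynomial ι K)).restrictScalars K
      ).map_aeval_mvPolynomial (fun i => Polynomial.C (X i) - Polynomial.X * Polynomial.C (v i)) G
    simp only [Derivation.restrictScalars_apply, Polynomial.derivative'_apply,
      Polynomial.derivative_sub, Polynomial.derivative_C, Polynomial.derivative_mul,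
      Polynomial.derivative_X, one_mul, mul_zero, add_zero, zero_sub] at this
    change Polynomial.derivative (φ G) = ∑ i, φ (pderiv i G) * -Polynomial.C (v i) at this
    rw [this]
    calc ∑ i, φ (pderiv i G) * -Polynomial.C (v i)
        = -∑ j, Polynomial.C (X j) * φ (∑ i, C (w i j) * pderiv i G) := by
          simp only [v, map_sum, map_mul, hφC, Finset.mul_sum, ← Finset.sum_neg_distrib]
          rw [Finset.sum_comm]
          exact Finset.sum_congr rfl fun j _ => Finset.sum_congr rfl fun i _ => by ring
      _ = 0 := by simp [hw]
  obtain ⟨a, ha⟩ := Polynomial.natDegree_eq_zero.1 (Polynomial.derivative_eq_zero.1 hder)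
  have heval (c : MvPolynomial ι K) :
      (φ G).eval c = aeval (fun i => X i - c * v i) G := by
    have : ((Polynomial.aeval c).restrictScalars K).comp φ =
        aeval (R := K) (fun i => X i - c * v i) := by
      ext i : 1
      simp [φ, mul_comm c]
    simpa [Polynomial.aeval_def] using congrArg (fun ψ => ψ G) this
  have h0 := heval 0
  have h1 := heval 1
  rw [← ha, Polynomial.eval_C] at h0 h1
  simp only [zero_mul, sub_zero, one_mul] at h0 h1
  rw [← h1, h0]
  exact aeval_X_left_apply G

section AffineForms

variable {R ι κ : Type*} [CommRing R] [Fintype ι] [Fintype κ]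

/-- The affine forms `∑ i, p t i X_i + r t`. -/
noncomputable def affineForm (p : Matrix κ ι R) (r : κ → R) (t : κ) : MvPolynomial ι R :=
  ∑ i, C (p t i) * X i + C (r t)

variable (K : Type*) [Field K] [Algebra R K]

/-- Substitution inverting the affine forms with the help of a right inverse `s` of `p`. -/
noncomputable def affineSection (s : Matrix ι κ K) (r : κ → R) :
    MvPolynomial ι R →ₐ[R] MvPolynomial κ K :=
  aeval fun i => ∑ t, C (s i t) * (X t - C (algebraMap R K (r t)))

variable {K}

theorem affineSection_affineForm [DecidableEq κ] {p : Matrix κ ι R} {s : Matrix ι κ K} (r : κ → R)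
    (h : p.map (algebraMap R K) * s = 1) (t : κ) :
    affineSection K s r (affineForm p r t) = X t := by
  have h1 (u : κ) : ∑ i, algebraMap R K (p t i) * s i u = if t = u then 1 else 0 := by
    simpa [Matrix.mul_apply, Matrix.one_apply] using congrFun (congrFun h t) u
  have h2 : ∑ i, C (algebraMap R K (p t i)) *
      ∑ u, C (s i u) * (X u - C (algebraMap R K (r u))) =
      ∑ u, C (∑ i, algebraMap R K (p t i) * s i u) * (X u - C (algebraMap R K (r u))) := by
    simp only [Finset.mul_sum, map_sum, Finset.sum_mul, map_mul]
    rw [Finset.sum_comm]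
    exact Finset.sum_congr rfl fun u _ => Finset.sum_congr rfl fun i _ => by ring
  simp only [affineForm, affineSection, map_add, map_sum, map_mul, aeval_X, algHom_C,
    MvPolynomial.algebraMap_apply, h2, h1]
  simp

theorem affineSection_aeval_affineForm [DecidableEq κ] {p : Matrix κ ι R} {s : Matrix ι κ K}
    (r : κ → R) (h : p.map (algebraMap R K) * s = 1) (Q : MvPolynomial κ R) :
    affineSection K s r (aeval (affineForm p r) Q) = map (algebraMap R K) Q := by
  induction Q using MvPolynomial.induction_on with
  | C a => simp [MvPolynomial.algebraMap_apply, algHom_C]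
  | add P Q hP hQ => simp only [map_add, hP, hQ]
  | mul_X P t hP => simp only [map_mul, aeval_X, hP, affineSection_affineForm r h, map_X]

theorem map_mul_inv_smul_map_eq_one {R K ι κ : Type*} [CommRing R] [Field K] [Algebra R K]
    [IsFractionRing R K] [Fintype ι] [DecidableEq κ] {p : Matrix κ ι R}
    {s : Matrix ι κ R} {Δ : R} (hΔ : Δ ≠ 0) (h : p * s = Δ • (1 : Matrix κ κ R)) :
    p.map (algebraMap R K) * ((algebraMap R K Δ)⁻¹ • s.map (algebraMap R K)) = 1 := by
  have hΔ' : algebraMap R K Δ ≠ 0 := (map_ne_zero_iff _ (IsFractionRing.injective R K)).2 hΔ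
  rw [Matrix.mul_smul, ← Matrix.map_mul, h]
  ext i j
  by_cases hij : i = j <;> simp [Matrix.one_apply, hij, hΔ']

theorem aeval_affineForm_injective [IsDomain R] [DecidableEq κ] {p : Matrix κ ι R}
    {s : Matrix ι κ R} {Δ : R} (hΔ : Δ ≠ 0) (h : p * s = Δ • (1 : Matrix κ κ R)) (r : κ → R) :
    Function.Injective (aeval (R := R) (affineForm p r)) := by
  intro P Q hPQ
  have hs := map_mul_inv_smul_map_eq_one (K := FractionRing R) hΔ h
  apply map_injective _ (IsFractionRing.injective R (FractionRing R))
  rw [← affineSection_aeval_affineForm r hs, ← affineSection_aeval_affineForm r hs, hPQ]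

theorem aeval_affineForm_affineSection [CharZero K] [DecidableEq κ] {p : Matrix κ ι R}
    {s : Matrix ι κ K} (r : κ → R) (h : p.map (algebraMap R K) * s = 1) (F : MvPolynomial ι R)
    (hF : ∀ v : ι → K, (p.map (algebraMap R K)).mulVec v = 0 →
      ∑ i, C (v i) * pderiv i (map (algebraMap R K) F) = 0) :
    aeval (affineForm (p.map (algebraMap R K)) (fun t => algebraMap R K (r t)))
      (affineSection K s r F) = map (algebraMap R K) F := by
  classical
  let w : Matrix ι ι K := 1 - s * p.map (algebraMap R K)
  have hpw : p.map (algebraMap R K) * w = 0 := by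
    rw [Matrix.mul_sub, Matrix.mul_one, ← Matrix.mul_assoc, h, Matrix.one_mul, sub_self]
  have key := aeval_X_sub_eq_self (map (algebraMap R K) F) w fun j =>
    hF (fun i => w i j) (by
      ext t
      simpa [Matrix.mul_apply, Matrix.mulVec, dotProduct] using congrFun (congrFun hpw t) j)
  rw [← key, aeval_map_algebraMap]
  have : ((aeval (affineForm (p.map (algebraMap R K)) (fun t => algebraMap R K (r t)))
      ).restrictScalars R).comp (affineSection K s r) =
      aeval (R := R) fun i => X i - ∑ j, C (w i j) * X j := by
    ext i : 1
    have hw (j : ι) : w i j = (if i = j then 1 else 0) - ∑ t, s i t * algebraMap R K (p t j) := by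
      simp [w, Matrix.mul_apply, Matrix.one_apply]
    simp only [AlgHom.comp_apply, affineSection, aeval_X, AlgHom.restrictScalars_apply, map_sum,
      map_mul, map_sub, algHom_C, MvPolynomial.algebraMap_apply, hw, affineForm,
      Algebra.algebraMap_self, RingHom.id_apply]
    simp [sub_mul, Finset.mul_sum, Finset.sum_mul, apply_ite C, ite_mul]
    rw [Finset.sum_comm]
    exact Finset.sum_congr rfl fun u _ => Finset.sum_congr rfl fun i _ => by ring
  exact congrArg (fun ψ => ψ F) this

/-- Denominators of the substituted polynomial are powers of `Δ`. -/
theorem exists_pow_mul_affineSection_eq_map {R K ι κ : Type*} [CommRing R] [Field K]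
    [Algebra R K] [IsFractionRing R K] [Fintype κ] {Δ : R} (hΔ : Δ ≠ 0)
    (s : Matrix ι κ R) (r : κ → R) (F : MvPolynomial ι R) :
    ∃ (N : ℕ) (P : MvPolynomial κ R),
      C (algebraMap R K Δ ^ N) *
        affineSection K ((algebraMap R K Δ)⁻¹ • s.map (algebraMap R K)) r F =
        map (algebraMap R K) P := by
  have hΔ' : algebraMap R K Δ ≠ 0 := (map_ne_zero_iff _ (IsFractionRing.injective R K)).2 hΔ
  induction F using MvPolynomial.induction_on with
  | C a => exact ⟨0, C a, by simp [MvPolynomial.algebraMap_apply, algHom_C]⟩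
  | add F G hF hG =>
    obtain ⟨N, P, hP⟩ := hF
    obtain ⟨N', P', hP'⟩ := hG
    refine ⟨N + N', C (Δ ^ N') * P + C (Δ ^ N) * P', ?_⟩
    simp only [map_add, map_mul, ← hP, ← hP', map_C, pow_add, map_pow]
    ring
  | mul_X F i hF =>
    obtain ⟨N, P, hP⟩ := hF
    refine ⟨N + 1, P * ∑ t, C (s i t) * (X t - C (r t)), ?_⟩
    have hi : C (algebraMap R K Δ) *
        affineSection K ((algebraMap R K Δ)⁻¹ • s.map (algebraMap R K)) r (X i) =
        map (algebraMap R K) (∑ t, C (s i t) * (X t - C (r t))) := by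
      simp only [affineSection, aeval_X, Finset.mul_sum, map_sum, map_mul, map_sub, map_C, map_X,
        Matrix.smul_apply, Matrix.map_apply, smul_eq_mul]
      refine Finset.sum_congr rfl fun t _ => ?_
      rw [← mul_assoc, ← mul_assoc, ← C_mul, mul_inv_cancel₀ hΔ', C_1, one_mul]
    rw [map_mul, map_mul, ← hP, ← hi, pow_succ, C_mul]
    ring

theorem exists_pow_mul_eq_aeval_affineForm [IsDomain R] [CharZero R] [DecidableEq κ]
    [IsFractionRing R K] {p : Matrix κ ι R} {s : Matrix ι κ R} {Δ : R} (hΔ : Δ ≠ 0)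
    (h : p * s = Δ • (1 : Matrix κ κ R)) (r : κ → R) (F : MvPolynomial ι R)
    (hF : ∀ v : ι → K, (p.map (algebraMap R K)).mulVec v = 0 →
      ∑ i, C (v i) * pderiv i (map (algebraMap R K) F) = 0) :
    ∃ (N : ℕ) (P : MvPolynomial κ R), C (Δ ^ N) * F = aeval (affineForm p r) P := by
  have : CharZero K := charZero_of_injective_algebraMap (IsFractionRing.injective R K)
  obtain ⟨N, P, hP⟩ := exists_pow_mul_affineSection_eq_map (K := K) hΔ s r F
  refine ⟨N, P, map_injective _ (IsFractionRing.injective R K) ?_⟩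
  have h1 := aeval_affineForm_affineSection r (map_mul_inv_smul_map_eq_one hΔ h) F hF
  rw [map_mul, ← h1, map_C, map_pow]
  have h2 := congrArg
    (aeval (R := K) (affineForm (p.map (algebraMap R K)) (fun t => algebraMap R K (r t)))) hP
  rw [map_mul, algHom_C, MvPolynomial.algebraMap_apply, Algebra.algebraMap_self,
    RingHom.id_apply] at h2
  rw [h2, aeval_map_algebraMap, map_aeval, aeval_def, coe_eval₂Hom]
  congr 1
  · ext a : 1
    simp [MvPolynomial.algebraMap_apply]
  · funext t
    simp [affineForm]

theorem mem_range_aeval_affineForm [IsDomain R] [UniqueFactorizationMonoid R] [CharZero R]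
    [DecidableEq κ] [IsFractionRing R K] {p : Matrix κ ι R}
    (hne : ∃ (s : Matrix ι κ R) (Δ : R), p * s = Δ • (1 : Matrix κ κ R) ∧ Δ ≠ 0)
    (hprime : ∀ g : R, Prime g →
      ∃ (s : Matrix ι κ R) (Δ : R), p * s = Δ • (1 : Matrix κ κ R) ∧ ¬ g ∣ Δ)
    (r : κ → R) (F : MvPolynomial ι R)
    (hF : ∀ v : ι → K, (p.map (algebraMap R K)).mulVec v = 0 →
      ∑ i, C (v i) * pderiv i (map (algebraMap R K) F) = 0) :
    ∃ Q : MvPolynomial κ R, F = aeval (affineForm p r) Q := by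
  obtain ⟨s, Δ, hs, hΔ⟩ := hne
  have hinj := aeval_affineForm_injective hΔ hs r
  suffices H : ∀ d : R, d ≠ 0 → (∃ P, C d * F = aeval (affineForm p r) P) →
      ∃ Q : MvPolynomial κ R, F = aeval (affineForm p r) Q by
    obtain ⟨N, P, hP⟩ := exists_pow_mul_eq_aeval_affineForm (K := K) hΔ hs r F hF
    exact H _ (pow_ne_zero N hΔ) ⟨P, hP⟩
  have hC (a : R) : aeval (affineForm p r) (C a : MvPolynomial κ R) = C a := by
    rw [algHom_C, MvPolynomial.algebraMap_apply, Algebra.algebraMap_self, RingHom.id_apply]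
  intro d
  induction d using UniqueFactorizationMonoid.induction_on_prime with
  | h₁ => exact fun h => absurd rfl h
  | h₂ d hd =>
    rintro - ⟨P, hP⟩
    obtain ⟨u, rfl⟩ := hd
    refine ⟨C (↑u⁻¹ : R) * P, ?_⟩
    rw [map_mul, hC, ← hP, ← mul_assoc, ← C_mul, Units.inv_mul, C_1, one_mul]
  | h₃ d g hd hg ih =>
    rintro - ⟨P, hP⟩
    obtain ⟨s', Δ', hs', hgΔ⟩ := hprime g hg
    have hΔ' : Δ' ≠ 0 := fun h0 => hgΔ (h0 ▸ dvd_zero g)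
    obtain ⟨N, P', hP'⟩ := exists_pow_mul_eq_aeval_affineForm (K := K) hΔ' hs' r F hF
    have hcross : C (g * d) * P' = C (Δ' ^ N) * P := by
      apply hinj
      rw [map_mul (aeval _), map_mul (aeval _), hC, hC, ← hP, ← hP']
      ring
    have hgC : Prime (C g : MvPolynomial κ R) := (MvPolynomial.prime_C_iff κ).2 hg
    have hdvd : (C g : MvPolynomial κ R) ∣ C (Δ' ^ N) * P :=
      ⟨C d * P', by rw [← hcross, C_mul, mul_assoc]⟩
    rcases hgC.dvd_or_dvd hdvd with h1 | ⟨P₁, rfl⟩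
    · rw [C_pow] at h1
      have h2 := (C_dvd_iff_dvd_coeff _ _).1 (hgC.dvd_of_dvd_pow h1) 0
      rw [coeff_zero_C] at h2
      exact absurd h2 hgΔ
    · refine ih hd ⟨P₁, ?_⟩
      rw [map_mul (aeval _), hC, C_mul, mul_assoc] at hP
      exact mul_left_cancel₀ (C_ne_zero.2 hg.ne_zero) hP

end AffineForms

/-- If `p M = 0` and the ranks of `p` and `M` add up, a vector annihilated by `p` lies in the
image of `M`. -/
theorem Matrix.exists_mulVec_eq_of_mulVec_eq_zero {K κ ι τ : Type*} [Field K] [Fintype κ]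
    [Fintype ι] [Fintype τ] {p : Matrix κ ι K} {M : Matrix ι τ K} (hpM : p * M = 0)
    (hrank : Fintype.card ι ≤ p.rank + M.rank) {v : ι → K} (hv : p.mulVec v = 0) :
    ∃ u, M.mulVec u = v := by
  have hle : LinearMap.range M.mulVecLin ≤ LinearMap.ker p.mulVecLin := by
    rw [LinearMap.range_le_ker_iff, ← Matrix.mulVecLin_mul, hpM, Matrix.mulVecLin_zero]
  have hfin := LinearMap.finrank_range_add_finrank_ker p.mulVecLin
  rw [Module.finrank_fintype_fun_eq_card] at hfin
  have heq := Submodule.eq_of_le_of_finrank_le hle (by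
    change _ ≤ M.rank
    change p.rank + _ = _ at hfin
    omega)
  have hmem : v ∈ LinearMap.range M.mulVecLin := by
    rw [heq]
    exact hv
  exact hmem

section TakiffField

variable {k} {L ι : Type*} [LieRing L] [LieAlgebra k L] [Fintype ι]

/-- The bracket `⁅b i, b j⁆` as a linear function on the dual. -/
noncomputable def bracketForm (b : Basis ι k L) (i j : ι) : MvPolynomial ι k :=
  ∑ r, C (b.repr ⁅b i, b j⁆ r) * X r

theorem isLieInvariant_iff [Infinite k] (b : Basis ι k L) (g : MvPolynomial ι k) :
    IsLieInvariant k b g ↔ ∀ j, ∑ i, pderiv i g * bracketForm b i j = 0 := by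
  refine forall_congr' fun j => ?_
  constructor
  · intro h
    refine MvPolynomial.funext fun c => ?_
    simpa [bracketForm, mul_comm] using h c
  · intro h c
    simpa [bracketForm, mul_comm] using congrArg (eval c) h

/-- The bracket of two basis vectors of the Takiff algebra as a linear function on its dual. -/
noncomputable def takiffField (b : Basis ι k L) (m : ℕ) (q p : Fin (m + 1) × ι) :
    MvPolynomial (Fin (m + 1) × ι) k :=
  if h : (q.1 : ℕ) + p.1 < m + 1 then
    rename (fun r => ((⟨q.1 + p.1, h⟩ : Fin (m + 1)), r)) (bracketForm b q.2 p.2)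
  else 0

theorem takiffBracket_single (m : ℕ) (i j s : Fin (m + 1)) (x y : L) :
    takiffBracket m (Pi.single i x) (Pi.single j y) s =
      if (i : ℕ) + j = s then ⁅x, y⁆ else 0 := by
  unfold takiffBracket
  rw [Finset.sum_eq_single i, Finset.sum_eq_single j]
  · simp
  · intro j' _ hj
    simp [Pi.single_eq_of_ne hj]
  · simp
  · intro i' _ hi
    simp [Pi.single_eq_of_ne hi]
  · simp

theorem takiffPairing_bracket_single (b : Basis ι k L) (m : ℕ) (c : Fin (m + 1) × ι → k)
    (q p : Fin (m + 1) × ι) :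
    takiffPairing k b m c
      (takiffBracket m (Pi.single q.1 (b q.2)) (Pi.single p.1 (b p.2))) =
      eval c (takiffField b m q p) := by
  simp only [takiffPairing, takiffBracket_single, Fintype.sum_prod_type, takiffField]
  split_ifs with h
  · rw [Finset.sum_eq_single (⟨q.1 + p.1, h⟩ : Fin (m + 1))]
    · simp [bracketForm, mul_comm]
    · intro s _ hs
      have hs' : ¬ (q.1 : ℕ) + p.1 = s := fun h' => hs (Fin.ext h'.symm)
      simp [hs']
    · simp
  · rw [map_zero]
    refine Finset.sum_eq_zero fun s _ => ?_
    have hs' : ¬ (q.1 : ℕ) + p.1 = s := fun h' => h (h' ▸ s.2)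
    simp [hs']

/-- The Hamiltonian derivation attached to a basis vector of the Takiff algebra. -/
noncomputable def takiffDer (b : Basis ι k L) (m : ℕ) (p : Fin (m + 1) × ι) :
    Derivation k (MvPolynomial (Fin (m + 1) × ι) k) (MvPolynomial (Fin (m + 1) × ι) k) :=
  mkDerivation k fun q => takiffField b m q p

theorem takiffDer_X (b : Basis ι k L) (m : ℕ) (p q : Fin (m + 1) × ι) :
    takiffDer b m p (X q) = takiffField b m q p :=
  mkDerivation_X _ _ _

theorem takiffDer_apply (b : Basis ι k L) (m : ℕ) (p : Fin (m + 1) × ι)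
    (F : MvPolynomial (Fin (m + 1) × ι) k) :
    takiffDer b m p F = ∑ q, pderiv q F * takiffField b m q p := by
  have h := Derivation.map_aeval_mvPolynomial (takiffDer b m p) X F
  simpa [takiffDer_X, aeval_X_left] using h

theorem isTakiffInvariant_iff [Infinite k] (b : Basis ι k L) (m : ℕ)
    (F : MvPolynomial (Fin (m + 1) × ι) k) :
    IsTakiffInvariant k b m F ↔ ∀ p, takiffDer b m p F = 0 := by
  refine forall_congr' fun p => ?_
  simp only [takiffPairing_bracket_single]
  constructor
  · intro h
    refine MvPolynomial.funext fun c => ?_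
    simpa [takiffDer_apply] using h c
  · intro h c
    simpa [takiffDer_apply] using congrArg (eval c) h

theorem takiffDer_castSucc_rename_succ (b : Basis ι k L) (m : ℕ) (s : Fin (m + 1)) (j : ι)
    (a : MvPolynomial (Fin (m + 1) × ι) k) :
    takiffDer b (m + 1) (s.castSucc, j) (rename (Prod.map Fin.succ id) a) =
      rename (Prod.map Fin.succ id) (takiffDer b m (s, j) a) := by
  have h := Derivation.map_aeval_mvPolynomial (takiffDer b (m + 1) (s.castSucc, j))
    (fun q => X (Prod.map Fin.succ id q)) a
  have hr (g : MvPolynomial (Fin (m + 1) × ι) k) :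
      aeval (fun q => X (Prod.map Fin.succ id q) :
        _ → MvPolynomial (Fin (m + 1 + 1) × ι) k) g = rename (Prod.map Fin.succ id) g := by
    rw [← aeval_X_left_apply (rename (Prod.map Fin.succ id) g), aeval_rename]
    rfl
  simp only [hr, takiffDer_X] at h
  rw [h, takiffDer_apply, map_sum]
  refine Finset.sum_congr rfl fun q _ => ?_
  rw [map_mul]
  congr 1
  simp only [takiffField, Prod.map_fst, Prod.map_snd, id, Fin.val_succ, Fin.val_castSucc]
  by_cases hq : (q.1 : ℕ) + s < m + 1
  · rw [dif_pos hq, dif_pos (by omega), rename_rename]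
    congr 2
    funext r
    refine Prod.ext (Fin.ext ?_) rfl
    simp only [Function.comp_apply, Prod.map_apply, Fin.val_succ]
    omega
  · rw [dif_neg hq, dif_neg (by omega), map_zero]

theorem takiffDer_last (b : Basis ι k L) (m : ℕ) (j : ι) (F : MvPolynomial (Fin (m + 1) × ι) k) :
    takiffDer b m (Fin.last m, j) F =
      ∑ i, pderiv (0, i) F * rename (fun r => (Fin.last m, r)) (bracketForm b i j) := by
  rw [takiffDer_apply, Fintype.sum_prod_type, Finset.sum_eq_single 0]
  · simp only [takiffField, Fin.val_zero, Fin.val_last, zero_add, Nat.lt_succ_self, dif_pos]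
    rfl
  · intro s _ hs
    refine Finset.sum_eq_zero fun i _ => ?_
    have : (s : ℕ) ≠ 0 := fun h => hs (Fin.ext h)
    rw [takiffField, dif_neg, mul_zero]
    simp only [Fin.val_last]
    omega
  · simp

end TakiffField

theorem MvPolynomial.sq_dvd_aeval_add_mul_sub {R ι B : Type*} [CommRing R] [CommRing B]
    [Algebra R B] [Fintype ι] (u x : ι → B) (t : B) (f : MvPolynomial ι R) :
    t ^ 2 ∣ aeval (fun i => u i + t * x i) f -
      (aeval u f + t * ∑ i, aeval u (pderiv i f) * x i) := by
  classical
  induction f using MvPolynomial.induction_on with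
  | C a => simp
  | add p q hp hq =>
    convert dvd_add hp hq using 1
    simp only [map_add, add_mul, Finset.sum_add_distrib]
    ring
  | mul_X p n hp =>
    obtain ⟨w, hw⟩ := hp
    rw [sub_eq_iff_eq_add] at hw
    refine ⟨w * (u n + t * x n) + (∑ i, aeval u (pderiv i p) * x i) * x n, ?_⟩
    have h1 : ∑ i, aeval u (pderiv i (p * X n)) * x i =
        (∑ i, aeval u (pderiv i p) * x i) * u n + aeval u p * x n := by
      simp only [Derivation.leibniz, pderiv_X, smul_eq_mul, map_add, map_mul, aeval_X, add_mul,
        Finset.sum_add_distrib]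
      rw [add_comm, Finset.sum_mul]
      congr 1
      · exact Finset.sum_congr rfl fun i _ => by ring
      · rw [Finset.sum_eq_single n]
        · simp
        · intro i _ hi
          simp [hi.symm]
        · simp
    rw [h1, map_mul, map_mul, hw, aeval_X, aeval_X]
    ring

section Polarization

variable {k} {ι : Type*}

/-- The generic `m`-jet in coordinates, with coefficients in reversed order. -/
noncomputable def genericJet (m : ℕ) (i : ι) : Polynomial (MvPolynomial (Fin (m + 1) × ι) k) :=
  ∑ r : Fin (m + 1), Polynomial.C (X (r, i)) * Polynomial.X ^ (m - (r : ℕ))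

theorem coeff_genericJet (m : ℕ) (i : ι) (n : ℕ) (hn : n ≤ m) :
    (genericJet m i : Polynomial (MvPolynomial (Fin (m + 1) × ι) k)).coeff n =
      X ((⟨m - n, by omega⟩ : Fin (m + 1)), i) := by
  rw [genericJet, Polynomial.finsetSum_coeff, Finset.sum_eq_single ⟨m - n, by omega⟩]
  · rw [Polynomial.coeff_C_mul_X_pow, if_pos]
    simp only
    omega
  · intro s _ hs
    rw [Polynomial.coeff_C_mul_X_pow, if_neg]
    intro h
    refine hs (Fin.ext ?_)
    have := s.2
    simp only
    omega
  · simp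

theorem coeff_zero_aeval_genericJet (m : ℕ) (g : MvPolynomial ι k) :
    (aeval (genericJet m) g).coeff 0 = rename (fun i => (Fin.last m, i)) g := by
  induction g using MvPolynomial.induction_on with
  | C a => simp [Polynomial.algebraMap_apply, algebraMap_eq]
  | add p q hp hq => simp [hp, hq]
  | mul_X p n hp =>
    rw [map_mul, Polynomial.mul_coeff_zero, hp, aeval_X, coeff_genericJet _ _ _ (Nat.zero_le _),
      map_mul, rename_X]
    rfl

theorem polarizationPoly_zero_zero (f : MvPolynomial ι k) :
    polarizationPoly k 0 f 0 = rename (fun i => (Fin.last 0, i)) f :=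
  coeff_zero_aeval_genericJet 0 f

theorem algebraicIndependent_polarizationPoly_zero {l : ℕ} (f : Fin l → MvPolynomial ι k)
    (halg : AlgebraicIndependent k f) :
    AlgebraicIndependent k
      (fun q : Fin l × Fin (0 + 1) => polarizationPoly k 0 (f q.1) (q.2 : ℕ)) := by
  have h := (halg.comp (Prod.fst : Fin l × Fin (0 + 1) → Fin l)
    (fun x y hxy => Prod.ext hxy (Fin.subsingleton_one.elim _ _))).map'
    (rename_injective (fun i : ι => (Fin.last 0, i)) (Prod.mk_right_injective _))
  convert h using 1
  funext q
  rw [Fin.val_eq_zero q.2]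
  exact polarizationPoly_zero_zero (f q.1)

variable [Fintype ι] {L : Type*} [LieRing L] [LieAlgebra k L]

theorem X_pow_dvd_mapCoeffs_genericJet_sub (b : Basis ι k L) (m : ℕ) (s : Fin (m + 1)) (i j : ι) :
    Polynomial.X ^ (m + 1) ∣
      PolynomialModule.equivPolynomialSelf.compDer (takiffDer b m (s, j)).mapCoeffs
        (genericJet m i) - Polynomial.X ^ (s : ℕ) * aeval (genericJet m) (bracketForm b i j) := by
  rw [Polynomial.X_pow_dvd_iff]
  intro n hn
  rw [Polynomial.coeff_sub, sub_eq_zero]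
  have h1 : (PolynomialModule.equivPolynomialSelf.compDer (takiffDer b m (s, j)).mapCoeffs
      (genericJet m i)).coeff n = takiffDer b m (s, j) ((genericJet m i).coeff n) := rfl
  rw [h1, coeff_genericJet _ _ _ (by omega), takiffDer_X, Polynomial.coeff_X_pow_mul', takiffField]
  by_cases hs : (s : ℕ) ≤ n
  · rw [if_pos hs, dif_pos (by simp only; omega)]
    simp only [bracketForm, map_sum, map_mul, Polynomial.finsetSum_coeff, aeval_X, rename_X,
      algHom_C, Polynomial.algebraMap_apply, Polynomial.coeff_C_mul, algebraMap_eq]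
    refine Finset.sum_congr rfl fun r _ => ?_
    rw [coeff_genericJet _ _ _ (by omega)]
    congr 4
    omega
  · rw [if_neg hs, dif_neg]
    simp only
    omega

theorem takiffDer_polarizationPoly (b : Basis ι k L) (m : ℕ) (f : MvPolynomial ι k)
    (hf : ∀ j, ∑ i, pderiv i f * bracketForm b i j = 0) (p : Fin (m + 1) × ι) (n : ℕ)
    (hn : n < m + 1) : takiffDer b m p (polarizationPoly k m f n) = 0 := by
  obtain ⟨s, j⟩ := p
  set D := PolynomialModule.equivPolynomialSelf.compDer (takiffDer b m (s, j)).mapCoeffs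
  suffices h : Polynomial.X ^ (m + 1) ∣ D (aeval (genericJet m) f) from
    Polynomial.X_pow_dvd_iff.1 h n hn
  rw [Derivation.map_aeval_mvPolynomial]
  have h0 : ∑ i, aeval (genericJet m) (pderiv i f) *
      (Polynomial.X ^ (s : ℕ) * aeval (genericJet m) (bracketForm b i j)) =
        (0 : Polynomial (MvPolynomial (Fin (m + 1) × ι) k)) := by
    have := congrArg (fun g => (Polynomial.X ^ (s : ℕ) * aeval (genericJet m) g :
      Polynomial (MvPolynomial (Fin (m + 1) × ι) k))) (hf j)
    simp only [map_sum, map_mul, map_zero, mul_zero, Finset.mul_sum] at this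
    rw [← this]
    exact Finset.sum_congr rfl fun i _ => by ring
  rw [← sub_zero (∑ i, _), ← h0, ← Finset.sum_sub_distrib]
  refine Finset.dvd_sum fun i _ => ?_
  rw [← mul_sub]
  exact (X_pow_dvd_mapCoeffs_genericJet_sub b m s i j).mul_left _

end Polarization

theorem MvPolynomial.polynomialMap_aeval {R A B ι : Type*} [CommRing R] [CommRing A] [CommRing B]
    [Algebra R A] [Algebra R B] (φ : A →ₐ[R] B) (u : ι → Polynomial A) (f : MvPolynomial ι R) :
    Polynomial.map φ.toRingHom (aeval u f) =
      aeval (fun i => Polynomial.map φ.toRingHom (u i)) f := by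
  induction f using MvPolynomial.induction_on with
  | C a => simp [Polynomial.algebraMap_apply]
  | add p q hp hq => rw [map_add, map_add, Polynomial.map_add, hp, hq]
  | mul_X p n hp => rw [map_mul, map_mul, Polynomial.map_mul, hp, aeval_X, aeval_X]

section Split

variable {ι : Type*}

/-- Separating the coordinates with index `0` from the others. -/
def finSuccProdEquiv (m : ℕ) (ι : Type*) : Fin (m + 1 + 1) × ι ≃ ι ⊕ Fin (m + 1) × ι where
  toFun q := Fin.cases (Sum.inl q.2) (fun r => Sum.inr (r, q.2)) q.1
  invFun := Sum.elim (fun i => (0, i)) (Prod.map Fin.succ id)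
  left_inv := by
    rintro ⟨r, i⟩
    cases r using Fin.cases <;> rfl
  right_inv := by rintro (i | ⟨r, i⟩) <;> rfl

/-- Polynomials on the dual of the `(m + 1)`-st Takiff algebra as polynomials in the coordinates
with index `0` over the polynomials on the dual of the `m`-th one. -/
noncomputable def splitEquiv (m : ℕ) (ι : Type*) :
    MvPolynomial (Fin (m + 1 + 1) × ι) k ≃ₐ[k]
      MvPolynomial ι (MvPolynomial (Fin (m + 1) × ι) k) :=
  (renameEquiv k (finSuccProdEquiv m ι)).trans (sumAlgEquiv k ι (Fin (m + 1) × ι))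

theorem splitEquiv_X_zero (m : ℕ) (i : ι) : splitEquiv k m ι (X (0, i)) = X i := by
  simp [splitEquiv, finSuccProdEquiv]

theorem splitEquiv_X_succ (m : ℕ) (r : Fin (m + 1)) (i : ι) :
    splitEquiv k m ι (X (r.succ, i)) = C (X (r, i)) := by
  simp [splitEquiv, finSuccProdEquiv]

theorem splitEquiv_rename_succ (m : ℕ) (a : MvPolynomial (Fin (m + 1) × ι) k) :
    splitEquiv k m ι (rename (Prod.map Fin.succ id) a) = C a := by
  have : ((splitEquiv k m ι).toAlgHom.comp (rename (Prod.map Fin.succ id))) =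
      IsScalarTower.toAlgHom k (MvPolynomial (Fin (m + 1) × ι) k) _ := by
    ext1 q
    simpa [Prod.map] using splitEquiv_X_succ k m q.1 q.2
  exact DFunLike.congr_fun this a

theorem splitEquiv_symm_C (m : ℕ) (a : MvPolynomial (Fin (m + 1) × ι) k) :
    (splitEquiv k m ι).symm (C a) = rename (Prod.map Fin.succ id) a := by
  rw [AlgEquiv.symm_apply_eq, splitEquiv_rename_succ]

theorem splitEquiv_pderiv_zero (m : ℕ) (i : ι) (F : MvPolynomial (Fin (m + 1 + 1) × ι) k) :
    splitEquiv k m ι (pderiv (0, i) F) = pderiv i (splitEquiv k m ι F) := by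
  simp only [splitEquiv, AlgEquiv.trans_apply, renameEquiv_apply, pderiv_sumAlgEquiv]
  rw [← pderiv_rename (finSuccProdEquiv m ι).injective]
  rfl

theorem map_splitEquiv_genericJet (m : ℕ) (i : ι) :
    Polynomial.map (splitEquiv k m ι).toRingEquiv.toRingHom (genericJet (m + 1) i) =
      Polynomial.map C (genericJet m i) + Polynomial.X ^ (m + 1) * Polynomial.C (X i) := by
  rw [genericJet, Fin.sum_univ_succ, genericJet]
  simp only [Polynomial.map_add, Polynomial.map_sum, Polynomial.map_mul, Polynomial.map_pow,
    Polynomial.map_C, Polynomial.map_X, RingEquiv.toRingHom_eq_coe, RingHom.coe_coe,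
    AlgEquiv.coe_ringEquiv, splitEquiv_X_zero, splitEquiv_X_succ,
    Fin.val_zero, Fin.val_succ, Nat.add_sub_add_right, Nat.sub_zero]
  ring

variable [Fintype ι]

theorem exists_map_splitEquiv_aeval_genericJet (m : ℕ) (f : MvPolynomial ι k) :
    ∃ w, Polynomial.map (splitEquiv k m ι).toRingEquiv.toRingHom (aeval (genericJet (m + 1)) f) =
      Polynomial.map C (aeval (genericJet m) f) +
        Polynomial.X ^ (m + 1) *
          (∑ i, Polynomial.map C (aeval (genericJet m) (pderiv i f)) * Polynomial.C (X i) +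
            Polynomial.X * w) := by
  obtain ⟨w, hw⟩ := sq_dvd_aeval_add_mul_sub
    (fun i => Polynomial.map C (genericJet m i : Polynomial (MvPolynomial (Fin (m + 1) × ι) k)))
    (fun i => Polynomial.C (X i)) (Polynomial.X ^ (m + 1)) f
  rw [sub_eq_iff_eq_add] at hw
  have hE' : Polynomial.map (splitEquiv k m ι).toRingEquiv.toRingHom
      (aeval (genericJet (m + 1)) f) = aeval (fun i => Polynomial.map C (genericJet m i) +
        Polynomial.X ^ (m + 1) * Polynomial.C (X i)) f := by
    simp only [← map_splitEquiv_genericJet]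
    exact MvPolynomial.polynomialMap_aeval (splitEquiv k m ι).toAlgHom _ f
  have hC' (g : MvPolynomial ι k) : Polynomial.map C (aeval (genericJet m) g) =
      aeval (fun i => (Polynomial.map C (genericJet m i) : Polynomial (MvPolynomial ι
        (MvPolynomial (Fin (m + 1) × ι) k)))) g :=
    MvPolynomial.polynomialMap_aeval (IsScalarTower.toAlgHom k (MvPolynomial (Fin (m + 1) × ι) k)
      (MvPolynomial ι (MvPolynomial (Fin (m + 1) × ι) k))) _ g
  refine ⟨Polynomial.X ^ m * w, ?_⟩
  simp only [hE', hw, hC']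
  ring

theorem splitEquiv_polarizationPoly (m : ℕ) (f : MvPolynomial ι k) (j : ℕ) (hj : j < m + 1) :
    splitEquiv k m ι (polarizationPoly k (m + 1) f j) = C (polarizationPoly k m f j) := by
  obtain ⟨w, hw⟩ := exists_map_splitEquiv_aeval_genericJet k m f
  have := congrArg (fun P => Polynomial.coeff P j) hw
  simp only [Polynomial.coeff_add, Polynomial.coeff_map, Polynomial.coeff_X_pow_mul',
    if_neg (Nat.not_le.2 hj), add_zero] at this
  exact this

theorem rename_succ_polarizationPoly (m : ℕ) (f : MvPolynomial ι k) (j : ℕ) (hj : j < m + 1) :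
    rename (Prod.map Fin.succ id) (polarizationPoly k m f j) = polarizationPoly k (m + 1) f j := by
  apply (splitEquiv k m ι).injective
  rw [splitEquiv_rename_succ, splitEquiv_polarizationPoly k m f j hj]

/-- The differentials of the `f t` at the last component of a point. -/
noncomputable def jetGradient {κ : Type*} (m : ℕ) (f : κ → MvPolynomial ι k) :
    Matrix κ ι (MvPolynomial (Fin (m + 1) × ι) k) :=
  Matrix.of fun t i => rename (fun i => (Fin.last m, i)) (pderiv i (f t))

theorem splitEquiv_polarizationPoly_last {κ : Type*} (m : ℕ) (f : κ → MvPolynomial ι k) (t : κ) :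
    splitEquiv k m ι (polarizationPoly k (m + 1) (f t) (m + 1)) =
      affineForm (jetGradient k m f) (fun t => polarizationPoly k m (f t) (m + 1)) t := by
  obtain ⟨w, hw⟩ := exists_map_splitEquiv_aeval_genericJet k m (f t)
  have := congrArg (fun P => Polynomial.coeff P (m + 1)) hw
  simp only [Polynomial.coeff_add, Polynomial.coeff_map, Polynomial.coeff_X_pow_mul',
    le_refl, if_true, Nat.sub_self, Polynomial.mul_coeff_zero, Polynomial.coeff_X_zero, zero_mul,
    add_zero, Polynomial.finsetSum_coeff, Polynomial.coeff_C_zero,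
    coeff_zero_aeval_genericJet] at this
  exact this.trans (add_comm _ _)

end Split

theorem MvPolynomial.exists_rename_eq_of_dvd_rename {R σ τ : Type*} [CommRing R] [IsDomain R]
    {φ : τ → σ} (hφ : Function.Injective φ) {g : MvPolynomial σ R} {a : MvPolynomial τ R}
    (ha : a ≠ 0) (h : g ∣ rename φ a) : ∃ g₀, rename φ g₀ = g := by
  refine exists_rename_eq_of_vars_subset_range g φ hφ fun x hx => ?_
  have hne : rename φ a ≠ 0 := (map_ne_zero_iff _ (rename_injective φ hφ)).2 ha
  obtain ⟨w, hw⟩ := h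
  have hx' : x ∈ (rename φ a).vars := by
    rw [Finset.mem_coe, mem_vars_iff_degreeOf_ne_zero] at hx
    rw [mem_vars_iff_degreeOf_ne_zero, hw,
      degreeOf_mul_eq (fun h0 => hne (by rw [hw, h0, zero_mul]))
        (fun h0 => hne (by rw [hw, h0, mul_zero]))]
    omega
  obtain ⟨i, -, hi⟩ := mem_vars_rename φ a hx'
  exact ⟨i, hi⟩

section Gradient

variable {ι : Type*} [Fintype ι] {l : ℕ}

theorem exists_jetGradient_mul_eq_smul_one (m : ℕ) (f : Fin l → MvPolynomial ι k) {c : ι → k}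
    (hc : c ∈ omegaSet k f) :
    ∃ (s : Matrix ι (Fin l) (MvPolynomial (Fin (m + 1) × ι) k)) (Δ : MvPolynomial ι k),
      jetGradient k m f * s =
        rename (fun i => (Fin.last m, i)) Δ •
          (1 : Matrix (Fin l) (Fin l) (MvPolynomial (Fin (m + 1) × ι) k)) ∧ eval c Δ = 1 := by
  obtain ⟨s, Δ, h, hΔ⟩ := Matrix.exists_mul_eq_smul_one_of_specialization (aeval c)
    (Matrix.of fun t i => pderiv i (f t)) hc
  refine ⟨s.map (rename fun i => (Fin.last m, i)), Δ, ?_, hΔ⟩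
  have := congrArg (fun N : Matrix _ _ _ => N.map (rename fun i => (Fin.last m, i))) h
  simp only [Matrix.map_mul] at this
  refine this.trans ?_
  ext1 t t'
  by_cases htt : t = t' <;> simp [htt]

theorem exists_jetGradient_mul_eq_smul_one_not_dvd (m : ℕ) (f : Fin l → MvPolynomial ι k)
    (hne : (omegaSet k f).Nonempty)
    (hbig : ∀ g : MvPolynomial ι k, 0 < g.totalDegree → ∃ c, eval c g = 0 ∧ c ∈ omegaSet k f)
    (g : MvPolynomial (Fin (m + 1) × ι) k) (hg : Prime g) :
    ∃ (s : Matrix ι (Fin l) (MvPolynomial (Fin (m + 1) × ι) k))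
      (Δ : MvPolynomial (Fin (m + 1) × ι) k),
      jetGradient k m f * s = Δ • (1 : Matrix (Fin l) (Fin l) _) ∧ ¬ g ∣ Δ := by
  obtain ⟨c, hc⟩ := hne
  obtain ⟨s, Δ, h, hΔ⟩ := exists_jetGradient_mul_eq_smul_one k m f hc
  by_cases hdvd : g ∣ rename (fun i => (Fin.last m, i)) Δ
  · have hΔ0 : Δ ≠ 0 := by
      rintro rfl
      simp at hΔ
    obtain ⟨g₀, rfl⟩ := exists_rename_eq_of_dvd_rename (Prod.mk_right_injective _) hΔ0 hdvd
    have hdeg : 0 < g₀.totalDegree := by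
      rw [Nat.pos_iff_ne_zero]
      intro h0
      rw [totalDegree_eq_zero_iff_eq_C] at h0
      have hcoeff : g₀.coeff 0 ≠ 0 := by
        intro h1
        rw [h1, map_zero] at h0
        exact hg.ne_zero (by rw [h0, map_zero])
      refine hg.not_isUnit ?_
      rw [h0]
      exact ((isUnit_iff_ne_zero.2 hcoeff).map C).map _
    obtain ⟨c', hc'0, hc'⟩ := hbig g₀ hdeg
    obtain ⟨s', Δ', h', hΔ'⟩ := exists_jetGradient_mul_eq_smul_one k m f hc'
    refine ⟨s', _, h', fun hd => ?_⟩
    have := map_dvd (eval fun q : Fin (m + 1) × ι => c' q.2) hd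
    rw [eval_rename, eval_rename] at this
    change eval c' g₀ ∣ eval c' Δ' at this
    rw [hc'0, hΔ', zero_dvd_iff] at this
    exact one_ne_zero this
  · exact ⟨s, _, h, hdvd⟩

variable {L : Type*} [LieRing L] [LieAlgebra k L]

/-- The Poisson tensor at the last component of a point. -/
noncomputable def jetBracket (b : Basis ι k L) (m : ℕ) :
    Matrix ι ι (MvPolynomial (Fin (m + 1) × ι) k) :=
  Matrix.of fun i j => rename (fun r => (Fin.last m, r)) (bracketForm b i j)

theorem jetGradient_mul_jetBracket (b : Basis ι k L) (m : ℕ) (f : Fin l → MvPolynomial ι k)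
    (hf : ∀ t j, ∑ i, pderiv i (f t) * bracketForm b i j = 0) :
    jetGradient k m f * jetBracket k b m = 0 := by
  ext1 t j
  have := congrArg (rename fun r => (Fin.last m, r)) (hf t j)
  simp only [map_sum, map_mul, map_zero] at this
  rw [Matrix.mul_apply]
  exact this

theorem finrank_coadStab_add_rank (b : Basis ι k L) (ξ : Module.Dual k L) :
    finrank k (coadStab k ξ) + (Matrix.of fun i j => ξ ⁅b i, b j⁆).rank = Fintype.card ι := by
  classical
  set N : Matrix ι ι k := Matrix.of fun i j => ξ ⁅b i, b j⁆
  have hker : (coadStab k ξ).map (b.equivFun : L →ₗ[k] ι → k) =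
      LinearMap.ker N.transpose.mulVecLin := by
    ext v
    rw [Submodule.mem_map_equiv, LinearMap.mem_ker]
    have hv : ∀ j, (N.transpose.mulVec v) j = ξ ⁅b.equivFun.symm v, b j⁆ := by
      intro j
      simp [Matrix.mulVec, dotProduct, N, Basis.equivFun_symm_apply, sum_lie, mul_comm]
    constructor
    · intro h
      ext j
      rw [Matrix.mulVecLin_apply, hv]
      exact h (b j)
    · intro h y
      have hz : ξ ∘ₗ (LieModule.toEnd k L L (b.equivFun.symm v) : L →ₗ[k] L) = 0 := by
        refine b.ext fun j => ?_
        have := congrFun h j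
        rw [Matrix.mulVecLin_apply, hv] at this
        exact this
      exact LinearMap.congr_fun hz y
  have hfr := LinearEquiv.finrank_map_eq b.equivFun (coadStab k ξ)
  rw [← Matrix.rank_transpose N, Matrix.rank, ← hfr, hker, add_comm,
    LinearMap.finrank_range_add_finrank_ker, finrank_fintype_fun_eq_card]

theorem card_le_lieIndex_add_rank_jetBracket (K : Type*) [Field K] (b : Basis ι k L) (m : ℕ)
    [Algebra (MvPolynomial (Fin (m + 1) × ι) k) K]
    [IsFractionRing (MvPolynomial (Fin (m + 1) × ι) k) K] :
    Fintype.card ι ≤ lieIndex k L + ((jetBracket k b m).map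
      (algebraMap (MvPolynomial (Fin (m + 1) × ι) k) K)).rank := by
  obtain ⟨ξ, hξ⟩ := Nat.sInf_mem (s := {d : ℕ | ∃ ξ : Module.Dual k L,
    d = finrank k (coadStab k ξ)}) ⟨_, 0, rfl⟩
  have hr := Matrix.rank_map_algHom_le K
    (aeval fun q : Fin (m + 1) × ι => ξ (b q.2) : _ →ₐ[k] k) (jetBracket k b m)
  have hm : (jetBracket k b m).map (aeval fun q : Fin (m + 1) × ι => ξ (b q.2) : _ →ₐ[k] k) =
      Matrix.of fun i j => ξ ⁅b i, b j⁆ := by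
    ext i j
    simp only [jetBracket, Matrix.map_apply, Matrix.of_apply, aeval_rename, bracketForm, map_sum,
      map_mul, aeval_X, algHom_C, Function.comp_apply]
    conv_rhs => rw [← b.sum_repr ⁅b i, b j⁆, map_sum]
    simp only [map_smul, smul_eq_mul, AlgHom.commutes, Algebra.algebraMap_self, RingHom.id_apply]
  rw [hm] at hr
  have := finrank_coadStab_add_rank k b ξ
  change lieIndex k L = _ at hξ
  omega

theorem omegaSet_nonempty (b : Basis ι k L) (f : Fin l → MvPolynomial ι k)
    (hl : l = lieIndex k L)
    (hbig : ∀ g : MvPolynomial ι k, 0 < g.totalDegree → ∃ c, eval c g = 0 ∧ c ∈ omegaSet k f) :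
    (omegaSet k f).Nonempty := by
  rcases isEmpty_or_nonempty ι with hι | ⟨⟨i⟩⟩
  · have h0 : l = 0 := by
      have := finrank_coadStab_add_rank k b 0
      rw [Fintype.card_eq_zero] at this
      have h1 : lieIndex k L ≤ finrank k (coadStab k (0 : Module.Dual k L)) := Nat.sInf_le ⟨0, rfl⟩
      omega
    subst h0
    exact ⟨0, linearIndependent_empty_type⟩
  · obtain ⟨c, -, hc⟩ := hbig (X i) (by simp)
    exact ⟨c, hc⟩

end Gradient

section Generation

variable {k} {L ι : Type*} [LieRing L] [LieAlgebra k L] [Fintype ι] {l : ℕ}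

theorem takiffDer_eq_zero_of_mem_adjoin (b : Basis ι k L) (m : ℕ) (f : Fin l → MvPolynomial ι k)
    (hf : ∀ t j, ∑ i, pderiv i (f t) * bracketForm b i j = 0)
    {F : MvPolynomial (Fin (m + 1) × ι) k}
    (hF : F ∈ Algebra.adjoin k (Set.range fun q : Fin l × Fin (m + 1) =>
      polarizationPoly k m (f q.1) (q.2 : ℕ))) (p : Fin (m + 1) × ι) :
    takiffDer b m p F = 0 := by
  induction hF using Algebra.adjoin_induction with
  | mem x hx =>
    obtain ⟨q, rfl⟩ := hx
    exact takiffDer_polarizationPoly b m (f q.1) (hf q.1) p q.2 q.2.2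
  | algebraMap r => exact Derivation.map_algebraMap _ r
  | add x y _ _ hx hy => rw [map_add, hx, hy, add_zero]
  | mul x y _ _ hx hy => rw [Derivation.leibniz, hx, hy, smul_zero, smul_zero, add_zero]

theorem mem_adjoin_polarizationPoly_zero [Infinite k] (b : Basis ι k L)
    (f : Fin l → MvPolynomial ι k)
    (hgen : ∀ g : MvPolynomial ι k, IsLieInvariant k b g → g ∈ Algebra.adjoin k (Set.range f))
    (F : MvPolynomial (Fin (0 + 1) × ι) k) (hF : ∀ p, takiffDer b 0 p F = 0) :
    F ∈ Algebra.adjoin k (Set.range fun q : Fin l × Fin (0 + 1) =>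
      polarizationPoly k 0 (f q.1) (q.2 : ℕ)) := by
  have hinj : Function.Injective fun i : ι => (Fin.last 0, i) := Prod.mk_right_injective _
  obtain ⟨g, rfl⟩ := exists_rename_eq_of_vars_subset_range F _ hinj
    fun q _ => ⟨q.2, Prod.ext (Fin.subsingleton_one.elim _ _) rfl⟩
  have hg : g ∈ Algebra.adjoin k (Set.range f) := by
    refine hgen g ((isLieInvariant_iff b g).2 fun j => ?_)
    apply rename_injective _ hinj
    have := hF (Fin.last 0, j)
    rw [takiffDer_last] at this
    rw [map_zero, map_sum, ← this]
    refine Finset.sum_congr rfl fun i _ => ?_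
    rw [map_mul, ← pderiv_rename hinj]
    rfl
  have hle : Algebra.adjoin k (Set.range f) ≤ (Algebra.adjoin k
      (Set.range fun q : Fin l × Fin (0 + 1) => polarizationPoly k 0 (f q.1) (q.2 : ℕ))).comap
        (rename fun i : ι => (Fin.last 0, i)) := by
    refine Algebra.adjoin_le ?_
    rintro _ ⟨t, rfl⟩
    exact Algebra.subset_adjoin ⟨(t, 0), polarizationPoly_zero_zero (f t)⟩
  exact hle hg

theorem algebraicIndependent_polarizationPoly_succ (m : ℕ) (f : Fin l → MvPolynomial ι k)
    (hne : (omegaSet k f).Nonempty)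
    (ih : AlgebraicIndependent k
      (fun q : Fin l × Fin (m + 1) => polarizationPoly k m (f q.1) (q.2 : ℕ))) :
    AlgebraicIndependent k
      (fun q : Fin l × Fin (m + 1 + 1) => polarizationPoly k (m + 1) (f q.1) (q.2 : ℕ)) := by
  obtain ⟨c, hc⟩ := hne
  obtain ⟨s, Δ, h, hΔ⟩ := exists_jetGradient_mul_eq_smul_one k m f hc
  have hΔ0 : Δ ≠ 0 := by
    rintro rfl
    simp at hΔ
  have hy : AlgebraicIndependent (MvPolynomial (Fin (m + 1) × ι) k)
      (affineForm (jetGradient k m f) fun t => polarizationPoly k m (f t) (m + 1)) :=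
    aeval_affineForm_injective ((map_ne_zero_iff _
      (rename_injective _ (Prod.mk_right_injective _))).2 hΔ0) h _
  let τ : Fin l × Fin (m + 1 + 1) → Fin l ⊕ Fin l × Fin (m + 1) :=
    fun q => Fin.lastCases (Sum.inl q.1) (fun j => Sum.inr (q.1, j)) q.2
  have hτ : Function.Injective τ := by
    refine Function.LeftInverse.injective
      (g := Sum.elim (fun t => (t, Fin.last (m + 1))) fun q => (q.1, q.2.castSucc)) ?_
    rintro ⟨t, j⟩
    cases j using Fin.lastCases <;> simp [τ]
  have := ((ih.sumElim_comp hy).map' (f := (splitEquiv k m ι).symm.toAlgHom)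
    (splitEquiv k m ι).symm.injective).comp τ hτ
  convert this using 1
  funext ⟨t, j⟩
  apply (splitEquiv k m ι).injective
  cases j using Fin.lastCases with
  | last => simp [τ, splitEquiv_polarizationPoly_last]
  | cast j => simp [τ, splitEquiv_polarizationPoly k m (f t) j j.2]

theorem splitEquiv_symm_affineForm (m : ℕ) (f : Fin l → MvPolynomial ι k) (t : Fin l) :
    (splitEquiv k m ι).symm
      (affineForm (jetGradient k m f) (fun t => polarizationPoly k m (f t) (m + 1)) t) =
      polarizationPoly k (m + 1) (f t) (m + 1) := by
  rw [AlgEquiv.symm_apply_eq, splitEquiv_polarizationPoly_last]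

theorem exists_takiffDer_splitEquiv_symm_aeval (b : Basis ι k L) (m : ℕ)
    (f : Fin l → MvPolynomial ι k)
    (hf : ∀ t j, ∑ i, pderiv i (f t) * bracketForm b i j = 0) (s : Fin (m + 1)) (j : ι)
    (Q : MvPolynomial (Fin l) (MvPolynomial (Fin (m + 1) × ι) k)) :
    ∃ Q' : MvPolynomial (Fin l) (MvPolynomial (Fin (m + 1) × ι) k),
      (∀ n, coeff n Q' = takiffDer b m (s, j) (coeff n Q)) ∧
      takiffDer b (m + 1) (s.castSucc, j) ((splitEquiv k m ι).symm (aeval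
        (affineForm (jetGradient k m f) fun t => polarizationPoly k m (f t) (m + 1)) Q)) =
      (splitEquiv k m ι).symm (aeval
        (affineForm (jetGradient k m f) fun t => polarizationPoly k m (f t) (m + 1)) Q') := by
  classical
  induction Q using MvPolynomial.induction_on with
  | C a =>
    refine ⟨C (takiffDer b m (s, j) a), fun n => ?_, ?_⟩
    · rw [coeff_C, coeff_C]
      split_ifs <;> simp
    · simp only [algHom_C, algebraMap_eq, splitEquiv_symm_C k, takiffDer_castSucc_rename_succ]
  | add p q hp hq =>
    obtain ⟨p', hp', hp⟩ := hp
    obtain ⟨q', hq', hq⟩ := hq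
    refine ⟨p' + q', fun n => by simp [hp', hq'], ?_⟩
    simp only [map_add, hp, hq]
  | mul_X p t hp =>
    obtain ⟨p', hp', hp⟩ := hp
    refine ⟨p' * X t, fun n => ?_, ?_⟩
    · rw [coeff_mul_X', coeff_mul_X']
      split_ifs <;> simp [hp']
    · simp only [map_mul, aeval_X, splitEquiv_symm_affineForm, Derivation.leibniz, hp,
        takiffDer_polarizationPoly b (m + 1) (f t) (hf t) _ (m + 1) (Nat.lt_succ_self _),
        smul_eq_mul]
      ring

theorem exists_splitEquiv_eq_aeval_affineForm [CharZero k] (b : Basis ι k L) (m : ℕ)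
    (f : Fin l → MvPolynomial ι k) (hl : l = lieIndex k L)
    (hf : ∀ t j, ∑ i, pderiv i (f t) * bracketForm b i j = 0)
    (hbig : ∀ g : MvPolynomial ι k, 0 < g.totalDegree → ∃ c, eval c g = 0 ∧ c ∈ omegaSet k f)
    (F : MvPolynomial (Fin (m + 1 + 1) × ι) k)
    (hF : ∀ j, takiffDer b (m + 1) (Fin.last (m + 1), j) F = 0) :
    ∃ Q : MvPolynomial (Fin l) (MvPolynomial (Fin (m + 1) × ι) k), splitEquiv k m ι F = aeval
      (affineForm (jetGradient k m f) fun t => polarizationPoly k m (f t) (m + 1)) Q := by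
  have hne := omegaSet_nonempty k b f hl hbig
  obtain ⟨c, hc⟩ := hne
  obtain ⟨s, Δ, h, hΔ⟩ := exists_jetGradient_mul_eq_smul_one k m f hc
  have hΔ0 : rename (fun i => (Fin.last m, i)) Δ ≠ 0 := by
    rw [map_ne_zero_iff _ (rename_injective _ (Prod.mk_right_injective _))]
    rintro rfl
    simp at hΔ
  set K := FractionRing (MvPolynomial (Fin (m + 1) × ι) k)
  refine mem_range_aeval_affineForm (K := K) ⟨s, _, h, hΔ0⟩
    (exists_jetGradient_mul_eq_smul_one_not_dvd k m f ⟨c, hc⟩ hbig) _ _ fun v hv => ?_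
  obtain ⟨u, rfl⟩ := Matrix.exists_mulVec_eq_of_mulVec_eq_zero
    (M := (jetBracket k b m).map (algebraMap _ K))
    (by rw [← Matrix.map_mul, jetGradient_mul_jetBracket k b m f hf]; simp)
    (by
      have h1 := Matrix.card_le_rank_of_mul_eq_smul_one (K := K) hΔ0 h
      have h2 := card_le_lieIndex_add_rank_jetBracket k K b m
      rw [Fintype.card_fin] at h1
      omega) hv
  have hj (j : ι) : ∑ i, C (algebraMap _ K (jetBracket k b m i j)) *
      pderiv i (map (algebraMap _ K) (splitEquiv k m ι F)) = 0 := by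
    have := congrArg (fun G => map (algebraMap _ K) (splitEquiv k m ι G)) (hF j)
    simp only [takiffDer_last, map_sum, map_mul, map_zero, splitEquiv_pderiv_zero] at this
    rw [← this]
    refine Finset.sum_congr rfl fun i _ => ?_
    have hren : rename (fun r => (Fin.last (m + 1), r)) (bracketForm b i j) =
        rename (Prod.map Fin.succ id) (jetBracket k b m i j) := by
      rw [jetBracket, Matrix.of_apply, rename_rename]
      rfl
    rw [hren, splitEquiv_rename_succ, map_C, pderiv_map, mul_comm]
  simp only [Matrix.mulVec, dotProduct, Matrix.map_apply, map_sum, map_mul, Finset.sum_mul]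
  rw [Finset.sum_comm]
  refine Finset.sum_eq_zero fun j _ => ?_
  have := congrArg (fun G => C (u j) * G) (hj j)
  simp only [Finset.mul_sum, mul_zero] at this
  rw [← this]
  exact Finset.sum_congr rfl fun i _ => by ring

theorem mem_adjoin_polarizationPoly_succ [CharZero k] (b : Basis ι k L) (m : ℕ)
    (f : Fin l → MvPolynomial ι k) (hl : l = lieIndex k L)
    (hf : ∀ t j, ∑ i, pderiv i (f t) * bracketForm b i j = 0)
    (hbig : ∀ g : MvPolynomial ι k, 0 < g.totalDegree → ∃ c, eval c g = 0 ∧ c ∈ omegaSet k f)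
    (ih : ∀ F : MvPolynomial (Fin (m + 1) × ι) k, (∀ p, takiffDer b m p F = 0) →
      F ∈ Algebra.adjoin k (Set.range fun q : Fin l × Fin (m + 1) =>
        polarizationPoly k m (f q.1) (q.2 : ℕ)))
    (F : MvPolynomial (Fin (m + 1 + 1) × ι) k) (hF : ∀ p, takiffDer b (m + 1) p F = 0) :
    F ∈ Algebra.adjoin k (Set.range fun q : Fin l × Fin (m + 1 + 1) =>
      polarizationPoly k (m + 1) (f q.1) (q.2 : ℕ)) := by
  obtain ⟨Q, hQ⟩ := exists_splitEquiv_eq_aeval_affineForm b m f hl hf hbig F fun j => hF _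
  rw [← AlgEquiv.eq_symm_apply] at hQ
  have hcoeff (n : Fin l →₀ ℕ) (p : Fin (m + 1) × ι) : takiffDer b m p (coeff n Q) = 0 := by
    obtain ⟨s, j⟩ := p
    obtain ⟨Q', hQ', hD⟩ := exists_takiffDer_splitEquiv_symm_aeval b m f hf s j Q
    rw [← hQ', ← coeff_zero n]
    congr 1
    rw [← hQ, hF, eq_comm, map_eq_zero_iff _ (splitEquiv k m ι).symm.injective] at hD
    obtain ⟨c, hc⟩ := omegaSet_nonempty k b f hl hbig
    obtain ⟨s', Δ, h, hΔ⟩ := exists_jetGradient_mul_eq_smul_one k m f hc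
    refine (map_eq_zero_iff _ (aeval_affineForm_injective ?_ h _)).1 hD
    rw [map_ne_zero_iff _ (rename_injective _ (Prod.mk_right_injective _))]
    rintro rfl
    simp at hΔ
  have hle : Algebra.adjoin k (Set.range fun q : Fin l × Fin (m + 1) =>
      polarizationPoly k m (f q.1) (q.2 : ℕ)) ≤ (Algebra.adjoin k
        (Set.range fun q : Fin l × Fin (m + 1 + 1) =>
          polarizationPoly k (m + 1) (f q.1) (q.2 : ℕ))).comap
        (rename (Prod.map Fin.succ id)) := by
    refine Algebra.adjoin_le ?_
    rintro _ ⟨q, rfl⟩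
    exact Algebra.subset_adjoin
      ⟨(q.1, q.2.castSucc), (rename_succ_polarizationPoly k m (f q.1) q.2 q.2.2).symm⟩
  rw [hQ, aeval_def, eval₂_eq', map_sum]
  refine Subalgebra.sum_mem _ fun n _ => ?_
  rw [map_mul, map_prod]
  refine Subalgebra.mul_mem _ ?_ (Subalgebra.prod_mem _ fun t _ => ?_)
  · rw [algebraMap_eq, splitEquiv_symm_C]
    exact hle (ih _ (hcoeff n))
  · rw [map_pow, splitEquiv_symm_affineForm]
    exact Subalgebra.pow_mem _ (Algebra.subset_adjoin
      (Set.mem_range_self (t, Fin.last (m + 1)))) _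

end Generation

/-- **Main theorem.** Let `q` be an algebraic Lie algebra such that
`k[q*]^q = k[f₁,…,f_l]` is a graded polynomial ring with `l = ind q`, and assume
the set `Ω_{q*}` where the differentials of the `f_i` are independent is big
(every hypersurface meets it).  Then for every `m ≥ 1` the symmetric invariants
`k[q⟨m⟩*]^{q⟨m⟩}` of the Takiff algebra form a graded polynomial ring of Krull
dimension `(m+1)·l`, freely generated by the polarizations `F_i^j`
(`1 ≤ i ≤ l`, `0 ≤ j ≤ m`). -/
theorem takiff_invariants_polynomial (L ι : Type*) [IsAlgClosed k] [CharZero k]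
    [LieRing L] [LieAlgebra k L] [Fintype ι] (b : Basis ι k L)
    (l : ℕ) (f : Fin l → MvPolynomial ι k)
    (hl : l = lieIndex k L)
    (hhom : ∀ t, ∃ d, (f t).IsHomogeneous d)
    (hinv : ∀ t, IsLieInvariant k b (f t))
    (halg : AlgebraicIndependent k f)
    (hgen : ∀ g : MvPolynomial ι k,
      IsLieInvariant k b g ↔ g ∈ Algebra.adjoin k (Set.range f))
    (hbig : ∀ g : MvPolynomial ι k, 0 < g.totalDegree →
      ∃ c, MvPolynomial.eval c g = 0 ∧ c ∈ omegaSet k f)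
    (m : ℕ) (hm : 1 ≤ m) :
    AlgebraicIndependent k
      (fun p : Fin l × Fin (m + 1) => polarizationPoly k m (f p.1) (p.2 : ℕ)) ∧
    ∀ F : MvPolynomial (Fin (m + 1) × ι) k,
      IsTakiffInvariant k b m F ↔
        F ∈ Algebra.adjoin k
          (Set.range fun p : Fin l × Fin (m + 1) =>
            polarizationPoly k m (f p.1) (p.2 : ℕ)) := by
  have hf (t : Fin l) := (isLieInvariant_iff b (f t)).1 (hinv t)
  clear hm
  constructor
  · induction m with
    | zero => exact algebraicIndependent_polarizationPoly_zero f halg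
    | succ m ih =>
      exact algebraicIndependent_polarizationPoly_succ m f (omegaSet_nonempty k b f hl hbig) ih
  · intro F
    rw [isTakiffInvariant_iff]
    refine ⟨?_, takiffDer_eq_zero_of_mem_adjoin b m f hf⟩
    induction m with
    | zero => exact mem_adjoin_polarizationPoly_zero b f (fun g => (hgen g).1) F
    | succ m ih => exact mem_adjoin_polarizationPoly_succ b m f hl hf hbig ih F
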